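/- arXiv:1401.0474 — 2 statements merged into one kernel-verified Lean document; each statement's English description precedes it below -/
import Mathlib

section
/- In W_1(xq^μ)⊗W_2(xq^{-μ}), the vectors v_{n,m} = Σ_{k=0}^{n} C(n,k)_{q^{-2}} v^{(1)}_{n-k}⊗v^{(2)}_{m+k} (q^{-2}-binomial coefficients) satisfy: Δ(e_0)v_{n,m}=v_{n+1,m}, Δ(e_1)v_{n,m} = x[n]_q[μ-n+1]_q v_{n-1,m} - x q^{-μ+2n+m-1}[m]_q/(q-q^{-1}) v_{n,m-1}, and Δ(h_1)v_{n,m} = -2(n+m)v_{n,m}, where Δ(e_0)=e_0⊗1+q^{-h_0}⊗e_0 etc. with e_0,e_1,h_0,h_1 acting via ρ^{(1)}_{xq^μ} on the first factor and ρ^{(2)}_{xq^{-μ}} on the second. -/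
namespace stmt13

/-- The model of W₁(xq^μ) ⊗ W₂(xq^{-μ}): basis `single (n,m) 1 = v⁽¹⁾ₙ ⊗ v⁽²⁾ₘ`. -/
abbrev V : Type := (ℕ × ℕ) →₀ ℂ

noncomputable def op (g : ℕ × ℕ → V) : V →ₗ[ℂ] V :=
  Finsupp.lsum ℂ fun p => LinearMap.toSpanSingleton ℂ V (g p)

/-- `e₁ ⊗ 1`. -/
noncomputable def e1 (q : ℂ) : V →ₗ[ℂ] V :=
  op fun p => Finsupp.single (p.1 - 1, p.2)
    (if p.1 = 0 then 0 else
      ((q ^ p.1 - q⁻¹ ^ p.1) / (q - q⁻¹)) * (q⁻¹ ^ p.1 * q) / (q - q⁻¹))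

/-- `f₁ ⊗ 1`. -/
noncomputable def f1 : V →ₗ[ℂ] V := op fun p => Finsupp.single (p.1 + 1, p.2) 1

/-- `1 ⊗ e₂`. -/
noncomputable def e2 (q : ℂ) : V →ₗ[ℂ] V :=
  op fun p => Finsupp.single (p.1, p.2 - 1)
    (if p.2 = 0 then 0 else
      -(((q ^ p.2 - q⁻¹ ^ p.2) / (q - q⁻¹)) * (q ^ p.2 * q⁻¹)) / (q - q⁻¹))

/-- `1 ⊗ f₂`. -/
noncomputable def f2 : V →ₗ[ℂ] V := op fun p => Finsupp.single (p.1, p.2 + 1) 1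

/-- `q^{h₁} ⊗ 1`. -/
noncomputable def qh1 (q : ℂ) : V →ₗ[ℂ] V :=
  op fun p => Finsupp.single p (q⁻¹ ^ (2 * p.1))

/-- `q^{-h₁} ⊗ 1`. -/
noncomputable def qmh1 (q : ℂ) : V →ₗ[ℂ] V :=
  op fun p => Finsupp.single p (q ^ (2 * p.1))

/-- `Δ(h₁) = h₁⊗1 + 1⊗h₂`, diagonal with eigenvalue `-2(n+m)`. -/
noncomputable def Dh1 : V →ₗ[ℂ] V :=
  op fun p => Finsupp.single p (-2 * (p.1 + p.2 : ℂ))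

noncomputable def pnum (p : ℂ) (k : ℕ) : ℂ := (1 - p ^ k) / (1 - p)
noncomputable def pfact (p : ℂ) (k : ℕ) : ℂ := ∏ i ∈ Finset.range k, pnum p (i + 1)
noncomputable def pbinom (p : ℂ) (n k : ℕ) : ℂ := pfact p n / (pfact p k * pfact p (n - k))

/-- `v_{n,m} = Σ_k C(n,k)_{q⁻²} v⁽¹⁾_{n-k} ⊗ v⁽²⁾_{m+k}`. -/
noncomputable def v (q : ℂ) (n m : ℕ) : V :=
  ∑ k ∈ Finset.range (n + 1), pbinom (q⁻¹ ^ 2) n k • Finsupp.single (n - k, m + k) (1 : ℂ)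

end stmt13

namespace stmt13

lemma op_single (g : ℕ × ℕ → V) (p : ℕ × ℕ) (c : ℂ) :
    op g (Finsupp.single p c) = c • g p := by
  simp [op]

lemma P_ne (q : ℂ) (hq : q ≠ 0) (hroot : ∀ n : ℕ, n ≠ 0 → q ^ n ≠ 1) (k : ℕ) :
    1 - (q⁻¹ ^ 2) ^ (k + 1) ≠ 0 := by
  intro h
  apply hroot (2 * (k + 1)) (by omega)
  have h1 : (q⁻¹ ^ 2) ^ (k + 1) = 1 := by linear_combination -h
  rw [← pow_mul, inv_pow, inv_eq_one] at h1
  exact h1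

lemma pfact_succ (p : ℂ) (k : ℕ) : pfact p (k + 1) = pfact p k * pnum p (k + 1) := by
  simp [pfact, Finset.prod_range_succ]

lemma pnum_ne (q : ℂ) (hq : q ≠ 0) (hroot : ∀ n : ℕ, n ≠ 0 → q ^ n ≠ 1) (k : ℕ) :
    pnum (q⁻¹ ^ 2) (k + 1) ≠ 0 := by
  have h := P_ne q hq hroot 0
  rw [zero_add, pow_one] at h
  exact div_ne_zero (P_ne q hq hroot k) h

lemma pfact_ne (q : ℂ) (hq : q ≠ 0) (hroot : ∀ n : ℕ, n ≠ 0 → q ^ n ≠ 1) (k : ℕ) :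
    pfact (q⁻¹ ^ 2) k ≠ 0 :=
  Finset.prod_ne_zero_iff.mpr fun i _ => pnum_ne q hq hroot i

lemma pbinom_zero (q : ℂ) (hq : q ≠ 0) (hroot : ∀ n : ℕ, n ≠ 0 → q ^ n ≠ 1) (n : ℕ) :
    pbinom (q⁻¹ ^ 2) n 0 = 1 := by
  have := pfact_ne q hq hroot n
  simp only [pbinom, Nat.sub_zero]
  rw [show pfact (q⁻¹ ^ 2) 0 = 1 by simp [pfact], one_mul, div_self this]

lemma pbinom_self (q : ℂ) (hq : q ≠ 0) (hroot : ∀ n : ℕ, n ≠ 0 → q ^ n ≠ 1) (n : ℕ) :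
    pbinom (q⁻¹ ^ 2) n n = 1 := by
  have := pfact_ne q hq hroot n
  simp only [pbinom, Nat.sub_self]
  rw [show pfact (q⁻¹ ^ 2) 0 = 1 by simp [pfact], mul_one, div_self this]

/-- `C(N+1,k) (N+1-k) = C(N,k) (N+1)`. -/
lemma pbinom_left (q : ℂ) (hq : q ≠ 0) (hroot : ∀ n : ℕ, n ≠ 0 → q ^ n ≠ 1) (k r : ℕ) :
    pbinom (q⁻¹ ^ 2) (k + r + 1) k * (1 - (q⁻¹ ^ 2) ^ (r + 1))
      = pbinom (q⁻¹ ^ 2) (k + r) k * (1 - (q⁻¹ ^ 2) ^ (k + r + 1)) := by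
  have h1 := pfact_ne q hq hroot k
  have h2 := pfact_ne q hq hroot r
  have h3 := P_ne q hq hroot 0
  have h4 := P_ne q hq hroot r
  rw [zero_add, pow_one] at h3
  unfold pbinom
  rw [show k + r + 1 - k = r + 1 by omega, show k + r - k = r by omega, pfact_succ, pfact_succ]
  unfold pnum
  generalize q⁻¹ ^ 2 = P at *
  field_simp

/-- `C(N+1,k+1) (k+1) = C(N,k) (N+1)`. -/
lemma pbinom_right (q : ℂ) (hq : q ≠ 0) (hroot : ∀ n : ℕ, n ≠ 0 → q ^ n ≠ 1) (k r : ℕ) :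
    pbinom (q⁻¹ ^ 2) (k + r + 1) (k + 1) * (1 - (q⁻¹ ^ 2) ^ (k + 1))
      = pbinom (q⁻¹ ^ 2) (k + r) k * (1 - (q⁻¹ ^ 2) ^ (k + r + 1)) := by
  have h1 := pfact_ne q hq hroot k
  have h2 := pfact_ne q hq hroot r
  have h3 := P_ne q hq hroot 0
  have h4 := P_ne q hq hroot k
  rw [zero_add, pow_one] at h3
  unfold pbinom
  rw [show k + r + 1 - (k + 1) = r by omega, show k + r - k = r by omega, pfact_succ, pfact_succ]
  unfold pnum
  generalize q⁻¹ ^ 2 = P at *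
  field_simp

/-- Pascal: `C(N+1,k+1) = C(N,k+1) + p^(N-k) C(N,k)` with `N = k + r + 1`. -/
lemma pbinom_pascal (q : ℂ) (hq : q ≠ 0) (hroot : ∀ n : ℕ, n ≠ 0 → q ^ n ≠ 1) (k r : ℕ) :
    pbinom (q⁻¹ ^ 2) (k + r + 2) (k + 1) = pbinom (q⁻¹ ^ 2) (k + r + 1) (k + 1)
      + (q⁻¹ ^ 2) ^ (r + 1) * pbinom (q⁻¹ ^ 2) (k + r + 1) k := by
  have a := pbinom_right q hq hroot k (r + 1)
  have b := pbinom_left q hq hroot (k + 1) r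
  have c := pbinom_right q hq hroot k r
  have d := pbinom_left q hq hroot k r
  have h4 := P_ne q hq hroot k
  have h5 := P_ne q hq hroot r
  rw [show k + (r + 1) + 1 = k + r + 2 by omega, show k + (r + 1) = k + r + 1 by omega] at a
  generalize q⁻¹ ^ 2 = P at *
  apply mul_right_cancel₀ h4
  apply mul_right_cancel₀ h5
  have e : pbinom P (k + r + 1) (k + 1) * (1 - P ^ (k + 1))
      = pbinom P (k + r + 1) k * (1 - P ^ (r + 1)) := by rw [c, d]
  linear_combination (1 - P ^ (r + 1)) * a - (1 - P ^ (r + 1)) * e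

lemma De0_v (q : ℂ) (hq : q ≠ 0) (hroot : ∀ n : ℕ, n ≠ 0 → q ^ n ≠ 1) (n m : ℕ) :
    (f1 + qh1 q ∘ₗ f2) (v q n m) = v q (n + 1) m := by
  have L : (f1 + qh1 q ∘ₗ f2) (v q n m)
      = ∑ k ∈ Finset.range (n + 1), pbinom (q⁻¹ ^ 2) n k • Finsupp.single (n + 1 - k, m + k) (1 : ℂ)
      + ∑ k ∈ Finset.range (n + 1), ((q⁻¹ ^ 2) ^ (n - k) * pbinom (q⁻¹ ^ 2) n k) •
          Finsupp.single (n - k, m + (k + 1)) (1 : ℂ) := by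
    rw [v, map_sum, ← Finset.sum_add_distrib]
    refine Finset.sum_congr rfl fun k hk => ?_
    have hk' : k ≤ n := by simpa [Nat.lt_succ_iff] using hk
    rw [map_smul, LinearMap.add_apply, LinearMap.comp_apply, f1, f2, qh1, op_single, op_single,
      map_smul, op_single]
    simp only [one_smul, smul_add, Finsupp.smul_single, smul_eq_mul, mul_one]
    rw [show n - k + 1 = n + 1 - k by omega, add_assoc m k 1, pow_mul, mul_comm (pbinom _ _ _)]
  rw [L, v, Finset.sum_range_succ' _ (n + 1), Finset.sum_range_succ' _ n,
    Finset.sum_range_succ _ n, Finset.sum_range_succ _ n]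
  have M : ∑ k ∈ Finset.range n, pbinom (q⁻¹ ^ 2) (n + 1) (k + 1) •
        Finsupp.single (n + 1 - (k + 1), m + (k + 1)) (1 : ℂ)
      = ∑ k ∈ Finset.range n, pbinom (q⁻¹ ^ 2) n (k + 1) •
        Finsupp.single (n + 1 - (k + 1), m + (k + 1)) (1 : ℂ)
      + ∑ k ∈ Finset.range n, ((q⁻¹ ^ 2) ^ (n - k) * pbinom (q⁻¹ ^ 2) n k) •
          Finsupp.single (n - k, m + (k + 1)) (1 : ℂ) := by
    rw [← Finset.sum_add_distrib]
    refine Finset.sum_congr rfl fun k hk => ?_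
    obtain ⟨r, rfl⟩ := Nat.exists_eq_add_of_lt (Finset.mem_range.mp hk)
    rw [show k + r + 1 + 1 = k + r + 2 by omega, pbinom_pascal q hq hroot,
      show k + r + 2 - (k + 1) = r + 1 by omega, show k + r + 1 - k = r + 1 by omega, add_smul]
  rw [M, pbinom_zero q hq hroot, pbinom_zero q hq hroot, pbinom_self q hq hroot,
    pbinom_self q hq hroot]
  simp only [Nat.sub_self, pow_zero, mul_one]
  abel

lemma Dh1_v (q : ℂ) (n m : ℕ) : Dh1 (v q n m) = (-2 * (n + m : ℂ)) • v q n m := by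
  rw [v, map_sum, Finset.smul_sum]
  refine Finset.sum_congr rfl fun k hk => ?_
  have hk' : k ≤ n := by simpa [Nat.lt_succ_iff] using hk
  rw [map_smul, Dh1, op_single, smul_comm]
  simp only [one_smul, Finsupp.smul_single, smul_eq_mul, mul_one]
  congr 1
  push_cast [Nat.cast_sub hk']
  ring

/-- Coefficients. -/
noncomputable def A (q : ℂ) (n : ℕ) : ℂ :=
  ((q ^ n - q⁻¹ ^ n) / (q - q⁻¹)) * (q⁻¹ ^ n * q) / (q - q⁻¹)

noncomputable def B (q : ℂ) (m : ℕ) : ℂ :=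
  -(((q ^ m - q⁻¹ ^ m) / (q - q⁻¹)) * (q ^ m * q⁻¹)) / (q - q⁻¹)

lemma De1_single (q y z : ℂ) (i j : ℕ) :
    (y • e1 q + z • (qmh1 q ∘ₗ e2 q)) (Finsupp.single (i, j) (1 : ℂ))
      = (y * A q i) • Finsupp.single (i - 1, j) (1 : ℂ)
        + (z * q ^ (2 * i) * B q j) • Finsupp.single (i, j - 1) (1 : ℂ) := by
  have hA : (if i = 0 then 0 else
      ((q ^ i - q⁻¹ ^ i) / (q - q⁻¹)) * (q⁻¹ ^ i * q) / (q - q⁻¹)) = A q i := by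
    split_ifs with h
    · simp [h, A]
    · rfl
  have hB : (if j = 0 then 0 else
      -(((q ^ j - q⁻¹ ^ j) / (q - q⁻¹)) * (q ^ j * q⁻¹)) / (q - q⁻¹)) = B q j := by
    split_ifs with h
    · simp [h, B]
    · rfl
  rw [LinearMap.add_apply, LinearMap.smul_apply, LinearMap.smul_apply, LinearMap.comp_apply,
    e1, e2, qmh1, op_single, op_single, map_smul, op_single]
  simp only [hA, hB, one_smul, Finsupp.smul_single, smul_eq_mul, mul_one]
  congr 2
  ring

lemma scal (q x t : ℂ) (hq : q ≠ 0) (ht : t ≠ 0) (hroot : ∀ n : ℕ, n ≠ 0 → q ^ n ≠ 1)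
    (k r m : ℕ) :
    pbinom (q⁻¹ ^ 2) (k + r + 1) k * (x * t * A q (r + 1))
      + pbinom (q⁻¹ ^ 2) (k + r + 1) (k + 1) * (x * t⁻¹ * q ^ (2 * r) * B q (m + (k + 1)))
    = (x * ((q ^ (k + r + 1) - q⁻¹ ^ (k + r + 1)) / (q - q⁻¹)) *
        ((t * q⁻¹ ^ (k + r + 1) * q - t⁻¹ * q ^ (k + r + 1) * q⁻¹) / (q - q⁻¹)))
        * pbinom (q⁻¹ ^ 2) (k + r) k
      - (x * t⁻¹ * q ^ (2 * (k + r + 1) + m) * q⁻¹ *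
          ((q ^ m - q⁻¹ ^ m) / (q - q⁻¹)) / (q - q⁻¹)) * pbinom (q⁻¹ ^ 2) (k + r + 1) (k + 1) := by
  have a := pbinom_left q hq hroot k r
  have b := pbinom_right q hq hroot k r
  have h4 := P_ne q hq hroot k
  have h5 := P_ne q hq hroot r
  have hd : q - q⁻¹ ≠ 0 := by
    intro h
    apply hroot 2 (by norm_num)
    field_simp at h
    linear_combination h
  rw [← eq_div_iff h5] at a
  rw [← eq_div_iff h4] at b
  rw [a, b]
  generalize pbinom (q⁻¹ ^ 2) (k + r) k = β
  have e4 : q ^ (2 * (k + 1)) - 1 ≠ 0 := sub_ne_zero.mpr (hroot _ (by omega))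
  have e5 : q ^ (2 * (r + 1)) - 1 ≠ 0 := sub_ne_zero.mpr (hroot _ (by omega))
  have hk : q ^ k ≠ 0 := pow_ne_zero _ hq
  have hr : q ^ r ≠ 0 := pow_ne_zero _ hq
  have hm : q ^ m ≠ 0 := pow_ne_zero _ hq
  unfold A B
  have Q : ∀ j : ℕ, (q ^ 2) ^ j = (q ^ j) ^ 2 := fun j => by rw [← pow_mul, ← pow_mul, mul_comm]
  clear a b h4 h5
  simp only [inv_pow, mul_comm 2, pow_add, pow_mul, pow_one] at *
  simp only [Q]
  clear Q hroot
  generalize q ^ k = K at *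
  generalize q ^ r = R at *
  generalize q ^ m = M at *
  generalize hD : q - q⁻¹ = D at *
  have E4 : 1 - (K ^ 2)⁻¹ * (q ^ 2)⁻¹ = ((K * q) ^ 2 - 1) / (K ^ 2 * q ^ 2) := by
    field_simp
  have E5 : 1 - (R ^ 2)⁻¹ * (q ^ 2)⁻¹ = ((R * q) ^ 2 - 1) / (R ^ 2 * q ^ 2) := by
    field_simp
  rw [E4, E5]
  generalize hU : (K * q) ^ 2 - 1 = U at *
  generalize hW : (R * q) ^ 2 - 1 = W at *
  field_simp
  subst hU hW
  ring

lemma De1_v (q x t : ℂ) (hq : q ≠ 0) (ht : t ≠ 0) (hroot : ∀ n : ℕ, n ≠ 0 → q ^ n ≠ 1)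
    (n m : ℕ) :
    ((x * t) • e1 q + (x * t⁻¹) • (qmh1 q ∘ₗ e2 q)) (v q n m)
        = (x * ((q ^ n - q⁻¹ ^ n) / (q - q⁻¹)) *
              ((t * q⁻¹ ^ n * q - t⁻¹ * q ^ n * q⁻¹) / (q - q⁻¹))) • v q (n - 1) m
          - (x * t⁻¹ * q ^ (2 * n + m) * q⁻¹ *
              ((q ^ m - q⁻¹ ^ m) / (q - q⁻¹)) / (q - q⁻¹)) • v q n (m - 1) := by
  have H0 : ∀ n, x * t⁻¹ * q ^ (2 * n) * B q m = -(x * t⁻¹ * q ^ (2 * n + m) * q⁻¹ *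
              ((q ^ m - q⁻¹ ^ m) / (q - q⁻¹)) / (q - q⁻¹)) := by
    intro n
    unfold B
    rw [pow_add]
    ring
  rcases n with _ | N
  · have A0 : A q 0 = 0 := by simp [A]
    simp only [v, zero_add, Finset.sum_range_one, pbinom_zero q hq hroot, one_smul, Nat.sub_self,
      add_zero, De1_single, A0, H0]
    simp
  · have L : ((x * t) • e1 q + (x * t⁻¹) • (qmh1 q ∘ₗ e2 q)) (v q (N + 1) m)
        = ∑ k ∈ Finset.range (N + 1), (pbinom (q⁻¹ ^ 2) (N + 1) k * (x * t * A q (N - k + 1))) •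
            Finsupp.single (N - k, m + k) (1 : ℂ)
        + (∑ k ∈ Finset.range (N + 1), (pbinom (q⁻¹ ^ 2) (N + 1) (k + 1) *
              (x * t⁻¹ * q ^ (2 * (N - k)) * B q (m + (k + 1)))) •
            Finsupp.single (N - k, m + k) (1 : ℂ)
          + (x * t⁻¹ * q ^ (2 * (N + 1)) * B q m) • Finsupp.single (N + 1, m - 1) (1 : ℂ)) := by
      rw [v, map_sum]
      simp only [map_smul, De1_single, smul_add, smul_smul]
      rw [Finset.sum_add_distrib]
      congr 1
      · rw [Finset.sum_range_succ, Nat.sub_self]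
        have A0 : A q 0 = 0 := by simp [A]
        rw [A0, mul_zero, mul_zero, zero_smul, add_zero]
        refine Finset.sum_congr rfl fun k hk => ?_
        have hk' := Finset.mem_range.mp hk
        rw [show N + 1 - k = N - k + 1 by omega, Nat.add_sub_cancel]
      · rw [Finset.sum_range_succ', pbinom_zero q hq hroot, one_mul, Nat.sub_zero, add_zero]
        congr 1
        refine Finset.sum_congr rfl fun k hk => ?_
        rw [show N + 1 - (k + 1) = N - k by omega, show m + (k + 1) - 1 = m + k by omega]
    have S : ∀ d : ℂ, (m = 0 → d = 0) → d • v q (N + 1) (m - 1)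
        = ∑ k ∈ Finset.range (N + 1), (d * pbinom (q⁻¹ ^ 2) (N + 1) (k + 1)) •
            Finsupp.single (N - k, m + k) (1 : ℂ)
          + d • Finsupp.single (N + 1, m - 1) (1 : ℂ) := by
      intro d hd
      by_cases hm : m = 0
      · simp [hd hm]
      · rw [v, Finset.sum_range_succ', pbinom_zero q hq hroot, one_smul, smul_add,
          Finset.smul_sum, Nat.sub_zero, add_zero]
        congr 1
        refine Finset.sum_congr rfl fun k hk => ?_
        rw [show N + 1 - (k + 1) = N - k by omega, show m - 1 + (k + 1) = m + k by omega,
          smul_smul]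
    rw [L, S _ (by rintro rfl; simp), H0, neg_smul, Nat.add_sub_cancel, v, Finset.smul_sum,
      ← add_assoc, ← Finset.sum_add_distrib, ← sub_eq_add_neg, ← sub_sub,
      ← Finset.sum_sub_distrib]
    congr 1
    refine Finset.sum_congr rfl fun k hk => ?_
    obtain ⟨r, rfl⟩ := Nat.exists_eq_add_of_le (Nat.lt_succ_iff.mp (Finset.mem_range.mp hk))
    rw [smul_smul, ← add_smul, ← sub_smul, Nat.add_sub_cancel_left, scal q x t hq ht hroot]

end stmt13

/-- in W₁(xq^μ)⊗W₂(xq^{-μ}), with `t = q^μ`, the vectors `v_{n,m}`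
satisfy `Δ(e₀)v_{n,m} = v_{n+1,m}`,
`Δ(e₁)v_{n,m} = x[n]_q[μ-n+1]_q v_{n-1,m} - x q^{-μ+2n+m-1}[m]_q/(q-q⁻¹) v_{n,m-1}`,
and `Δ(h₁)v_{n,m} = -2(n+m) v_{n,m}`, where
`Δ(e₀) = f₁⊗1 + q^{h₁}⊗f₂`, `Δ(e₁) = xq^μ e₁⊗1 + q^{-h₁}⊗ xq^{-μ} e₂`. -/
theorem stmt13 (q x t : ℂ) (hq : q ≠ 0) (hroot : ∀ n : ℕ, n ≠ 0 → q ^ n ≠ 1)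
    (hx : x ≠ 0) (ht : t ≠ 0)
    (De0 De1 : stmt13.V →ₗ[ℂ] stmt13.V)
    (hDe0 : De0 = stmt13.f1 + stmt13.qh1 q ∘ₗ stmt13.f2)
    (hDe1 : De1 = (x * t) • stmt13.e1 q + (x * t⁻¹) • (stmt13.qmh1 q ∘ₗ stmt13.e2 q)) :
    ∀ n m : ℕ,
      De0 (stmt13.v q n m) = stmt13.v q (n + 1) m ∧
      De1 (stmt13.v q n m)
        = (x * ((q ^ n - q⁻¹ ^ n) / (q - q⁻¹)) *
              ((t * q⁻¹ ^ n * q - t⁻¹ * q ^ n * q⁻¹) / (q - q⁻¹))) • stmt13.v q (n - 1) m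
          - (x * t⁻¹ * q ^ (2 * n + m) * q⁻¹ *
              ((q ^ m - q⁻¹ ^ m) / (q - q⁻¹)) / (q - q⁻¹)) • stmt13.v q n (m - 1) ∧
      stmt13.Dh1 (stmt13.v q n m) = (-2 * (n + m : ℂ)) • stmt13.v q n m := by
  subst hDe0 hDe1
  intro n m
  exact ⟨stmt13.De0_v q hq hroot n m, stmt13.De1_v q x t hq ht hroot n m, stmt13.Dh1_v q n m⟩
end

section
/- Matrix factorization of L-operators: with O = exp_{q^{-2}}(λ e_1⊗f_2) acting on W_1⊗W_2 (λ=q-q^{-1}), the 2×2-matrix identity O^{-1} L^{(1)}(xq^μ) L^{(2)}(xq^{-μ}) O = M(x) · [[1,0],[λx e_2,1]] · diag(q^{(h_2-μ)/2}, q^{-(h_2-μ)/2}) holds, where M(x) is the 2×2 matrix with entries M_{11}=q^{H_1/2}-q^{-1}xq^{-H_1/2}, M_{12}=λF_1q^{-H_1/2}, M_{21}=λxE_1q^{H_1/2}, M_{22}=q^{-H_1/2}-q^{-1}xq^{H_1/2}, with E_1=(q^μ-q^{-μ-h_1})e_1, F_1=f_1, H_1=h_1+μ. The matrix product on the left uses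 L^{(1)} acting on the first tensor factor and L^{(2)} on the second. -/
namespace stmt17

/-- The model of W₁ ⊗ W₂: basis `single (n,m) 1 = v⁽¹⁾ₙ ⊗ v⁽²⁾ₘ`. -/
abbrev V : Type := (ℕ × ℕ) →₀ ℂ

abbrev E := Module.End ℂ V

noncomputable def op (g : ℕ × ℕ → V) : E :=
  Finsupp.lsum ℂ fun p => LinearMap.toSpanSingleton ℂ V (g p)

/-- `e₁ ⊗ 1`. -/
noncomputable def e1 (q : ℂ) : E :=
  op fun p => Finsupp.single (p.1 - 1, p.2)
    (if p.1 = 0 then 0 else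
      ((q ^ p.1 - q⁻¹ ^ p.1) / (q - q⁻¹)) * (q⁻¹ ^ p.1 * q) / (q - q⁻¹))

/-- `f₁ ⊗ 1`. -/
noncomputable def f1 : E := op fun p => Finsupp.single (p.1 + 1, p.2) 1

/-- `1 ⊗ e₂`. -/
noncomputable def e2 (q : ℂ) : E :=
  op fun p => Finsupp.single (p.1, p.2 - 1)
    (if p.2 = 0 then 0 else
      -(((q ^ p.2 - q⁻¹ ^ p.2) / (q - q⁻¹)) * (q ^ p.2 * q⁻¹)) / (q - q⁻¹))

/-- `1 ⊗ f₂`. -/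
noncomputable def f2 : E := op fun p => Finsupp.single (p.1, p.2 + 1) 1

/-- `q^{h₁/2} ⊗ 1` (eigenvalue `q^{-n}`). -/
noncomputable def kh1 (q : ℂ) : E := op fun p => Finsupp.single p (q⁻¹ ^ p.1)
/-- `q^{-h₁/2} ⊗ 1`. -/
noncomputable def kh1i (q : ℂ) : E := op fun p => Finsupp.single p (q ^ p.1)
/-- `1 ⊗ q^{h₂/2}` (eigenvalue `q^{-m}`). -/
noncomputable def kh2 (q : ℂ) : E := op fun p => Finsupp.single p (q⁻¹ ^ p.2)
/-- `1 ⊗ q^{-h₂/2}`. -/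
noncomputable def kh2i (q : ℂ) : E := op fun p => Finsupp.single p (q ^ p.2)
/-- `q^{-h₁} ⊗ 1`. -/
noncomputable def qmh1 (q : ℂ) : E := op fun p => Finsupp.single p (q ^ (2 * p.1))

noncomputable def pnum (p : ℂ) (k : ℕ) : ℂ := (1 - p ^ k) / (1 - p)
noncomputable def pfact (p : ℂ) (k : ℕ) : ℂ := ∏ i ∈ Finset.range k, pnum p (i + 1)

/-- `O = exp_{q⁻²}((q-q⁻¹)·e₁⊗f₂)` (locally finite series). -/
noncomputable def Oop (q : ℂ) : E :=
  op fun p => ∑ k ∈ Finset.range (p.1 + 1),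
    (pfact (q⁻¹ ^ 2) k)⁻¹ • ((((q - q⁻¹) • (e1 q * f2)) ^ k) (Finsupp.single p 1))

/-- `L⁽¹⁾(y)`, with entries acting on the first tensor factor. -/
noncomputable def L1m (q y : ℂ) : Matrix (Fin 2) (Fin 2) E :=
  !![kh1 q, (q - q⁻¹) • (f1 * kh1i q);
     ((q - q⁻¹) * y) • (e1 q * kh1 q), kh1i q - (q⁻¹ * y) • kh1 q]

/-- `L⁽²⁾(y)`, with entries acting on the second tensor factor. -/
noncomputable def L2m (q y : ℂ) : Matrix (Fin 2) (Fin 2) E :=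
  !![kh2 q - (q⁻¹ * y) • kh2i q, (q - q⁻¹) • (f2 * kh2i q);
     ((q - q⁻¹) * y) • (e2 q * kh2 q), kh2i q]

/-- `E₁ = (q^μ - q^{-μ-h₁})e₁`, with `u = q^{μ/2}`. -/
noncomputable def E1op (q u : ℂ) : E := (u ^ 2 • (1 : E) - u⁻¹ ^ 2 • qmh1 q) * e1 q

/-- The matrix `M(x)` built from `E₁, F₁ = f₁, H₁ = h₁ + μ` (so `q^{H₁/2} = u·q^{h₁/2}`). -/
noncomputable def Mm (q u x : ℂ) : Matrix (Fin 2) (Fin 2) E :=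
  !![u • kh1 q - (q⁻¹ * x * u⁻¹) • kh1i q, ((q - q⁻¹) * u⁻¹) • (f1 * kh1i q);
     ((q - q⁻¹) * x * u) • (E1op q u * kh1 q), u⁻¹ • kh1i q - (q⁻¹ * x * u) • kh1 q]

/-- The lower-triangular factor `[[1,0],[λx e₂,1]]`. -/
noncomputable def Tm (q x : ℂ) : Matrix (Fin 2) (Fin 2) E :=
  !![(1 : E), 0; ((q - q⁻¹) * x) • e2 q, (1 : E)]

/-- The diagonal factor `diag(q^{(h₂-μ)/2}, q^{-(h₂-μ)/2})`. -/
noncomputable def Dm (q u : ℂ) : Matrix (Fin 2) (Fin 2) E :=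
  !![u⁻¹ • kh2 q, 0; 0, u • kh2i q]


theorem op_single (g : ℕ × ℕ → V) (p : ℕ × ℕ) (c : ℂ) :
    op g (Finsupp.single p c) = c • g p := by
  simp [op]

theorem E_ext {A B : E}
    (h : ∀ n m, A (Finsupp.single (n, m) 1) = B (Finsupp.single (n, m) 1)) : A = B := by
  apply Finsupp.lhom_ext'
  rintro ⟨n, m⟩
  apply LinearMap.ext_ring
  simpa using h n m

theorem lam_ne {q : ℂ} (hq : q ≠ 0) (hroot : ∀ n : ℕ, n ≠ 0 → q ^ n ≠ 1) : q - q⁻¹ ≠ 0 := by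
  intro h
  apply hroot 2 two_ne_zero
  field_simp at h
  linear_combination h

theorem lam_ne' {q : ℂ} (hroot : ∀ n : ℕ, n ≠ 0 → q ^ n ≠ 1) : q ^ 2 - 1 ≠ 0 := by
  intro h
  apply hroot 2 two_ne_zero
  linear_combination h

theorem e1_s {q : ℂ} (hq : q ≠ 0) (n m : ℕ) (c : ℂ) :
    e1 q (Finsupp.single (n, m) c)
      = Finsupp.single (n - 1, m) (c * (q * (1 - (q ^ n)⁻¹ ^ 2) / (q - q⁻¹) ^ 2)) := by
  rw [e1, op_single, Finsupp.smul_single, smul_eq_mul]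
  congr 2
  split_ifs with h
  · simp only at h
    simp [h]
  · simp only [inv_pow]
    field_simp

theorem e2_s {q : ℂ} (hq : q ≠ 0) (n m : ℕ) (c : ℂ) :
    e2 q (Finsupp.single (n, m) c)
      = Finsupp.single (n, m - 1) (c * (q⁻¹ * (1 - (q ^ m) ^ 2) / (q - q⁻¹) ^ 2)) := by
  rw [e2, op_single, Finsupp.smul_single, smul_eq_mul]
  congr 2
  split_ifs with h
  · simp only at h
    simp [h]
  · simp only [inv_pow]
    field_simp
    ring

theorem f1_s (n m : ℕ) (c : ℂ) :
    f1 (Finsupp.single (n, m) c) = Finsupp.single (n + 1, m) c := by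
  rw [f1, op_single]; simp
theorem f2_s (n m : ℕ) (c : ℂ) :
    f2 (Finsupp.single (n, m) c) = Finsupp.single (n, m + 1) c := by
  rw [f2, op_single]; simp
theorem kh1_s (q : ℂ) (n m : ℕ) (c : ℂ) :
    kh1 q (Finsupp.single (n, m) c) = Finsupp.single (n, m) (c * (q ^ n)⁻¹) := by
  rw [kh1, op_single]; simp
theorem kh1i_s (q : ℂ) (n m : ℕ) (c : ℂ) :
    kh1i q (Finsupp.single (n, m) c) = Finsupp.single (n, m) (c * q ^ n) := by
  rw [kh1i, op_single]; simp
theorem kh2_s (q : ℂ) (n m : ℕ) (c : ℂ) :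
    kh2 q (Finsupp.single (n, m) c) = Finsupp.single (n, m) (c * (q ^ m)⁻¹) := by
  rw [kh2, op_single]; simp
theorem kh2i_s (q : ℂ) (n m : ℕ) (c : ℂ) :
    kh2i q (Finsupp.single (n, m) c) = Finsupp.single (n, m) (c * q ^ m) := by
  rw [kh2i, op_single]; simp
theorem qmh1_eq (q : ℂ) : qmh1 q = kh1i q * kh1i q := by
  apply E_ext
  intro n m
  rw [qmh1, op_single, Module.End.mul_apply, kh1i_s, kh1i_s]
  simp [two_mul, pow_add]

noncomputable def Aop (q : ℂ) : E := (q - q⁻¹) • (e1 q * f2)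

theorem A_s {q : ℂ} (hq : q ≠ 0) (n m : ℕ) (c : ℂ) :
    Aop q (Finsupp.single (n, m) c)
      = Finsupp.single (n - 1, m + 1) (c * (q * (1 - (q ^ n)⁻¹ ^ 2) / (q - q⁻¹))) := by
  rw [Aop, LinearMap.smul_apply, Module.End.mul_apply, f2_s, e1_s hq, Finsupp.smul_single,
    smul_eq_mul]
  congr 1
  by_cases hl : q - q⁻¹ = 0
  · simp [hl]
  · field_simp

theorem A_pow_zero {q : ℂ} (hq : q ≠ 0) (n : ℕ) : ∀ (m : ℕ) (c : ℂ) (k : ℕ), n < k →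
    (Aop q ^ k) (Finsupp.single (n, m) c) = 0 := by
  induction n with
  | zero =>
    intro m c k hk
    obtain ⟨k, rfl⟩ : ∃ j, k = j + 1 := ⟨k - 1, by omega⟩
    rw [pow_succ, Module.End.mul_apply, A_s hq]
    simp
  | succ n ih =>
    intro m c k hk
    obtain ⟨k, rfl⟩ : ∃ j, k = j + 1 := ⟨k - 1, by omega⟩
    rw [pow_succ, Module.End.mul_apply, A_s hq]
    exact ih _ _ _ (by omega)

noncomputable def r (q : ℂ) (k : ℕ) : ℂ := (pfact (q⁻¹ ^ 2) k)⁻¹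

theorem pnum_ne {q : ℂ} (hroot : ∀ n : ℕ, n ≠ 0 → q ^ n ≠ 1) (k : ℕ) :
    pnum (q⁻¹ ^ 2) (k + 1) ≠ 0 := by
  have h : ∀ j : ℕ, 1 - (q⁻¹ ^ 2) ^ (j + 1) ≠ 0 := by
    intro j h
    apply hroot (2 * (j + 1)) (by omega)
    have : (q ^ (2 * (j + 1)))⁻¹ = 1 := by
      rw [← inv_pow, pow_mul]; linear_combination -h
    exact inv_eq_one.mp this
  exact div_ne_zero (h k) (by simpa using h 0)

theorem r_succ {q : ℂ} (hroot : ∀ n : ℕ, n ≠ 0 → q ^ n ≠ 1) (k : ℕ) :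
    r q (k + 1) * pnum (q⁻¹ ^ 2) (k + 1) = r q k := by
  have := pnum_ne hroot k
  rw [r, r, pfact, Finset.prod_range_succ, mul_inv, mul_assoc, inv_mul_cancel₀ this, mul_one, pfact]

theorem pnum_succ {q : ℂ} (hq : q ≠ 0) (hroot : ∀ n : ℕ, n ≠ 0 → q ^ n ≠ 1) (k : ℕ) :
    pnum (q⁻¹ ^ 2) (k + 1) = pnum (q⁻¹ ^ 2) k + (q⁻¹ ^ 2) ^ k := by
  have h : 1 - q⁻¹ ^ 2 ≠ 0 := by
    intro h
    apply hroot 2 two_ne_zero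
    field_simp at h
    linear_combination h
  rw [pnum, pnum]
  generalize q⁻¹ ^ 2 = p at *
  field_simp
  ring

noncomputable def ON (q : ℂ) (N : ℕ) : E := ∑ k ∈ Finset.range N, r q k • Aop q ^ k

theorem O_s {q : ℂ} (hq : q ≠ 0) (n m : ℕ) (c : ℂ) (N : ℕ) (hN : n < N) :
    Oop q (Finsupp.single (n, m) c) = ON q N (Finsupp.single (n, m) c) := by
  have h1 : Finsupp.single (n, m) c = c • (Finsupp.single (n, m) 1 : V) := by simp
  rw [h1, map_smul, map_smul, Oop, op_single, one_smul, ON, LinearMap.sum_apply]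
  congr 1
  simp only [LinearMap.smul_apply]
  apply Finset.sum_subset
  · intro k; simp only [Finset.mem_range]; omega
  · intro k _ hk
    simp only [Finset.mem_range, not_lt] at hk
    have h0 := A_pow_zero hq n m 1 k (by omega)
    rw [Aop] at h0
    rw [h0, smul_zero]

theorem O_eventually {q : ℂ} (hq : q ≠ 0) (v : V) :
    ∃ N0, ∀ N, N0 ≤ N → Oop q v = ON q N v := by
  induction v using Finsupp.induction_linear with
  | zero => exact ⟨0, fun N _ => by simp⟩
  | add f g hf hg =>
    obtain ⟨a, ha⟩ := hf
    obtain ⟨b, hb⟩ := hg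
    refine ⟨max a b, fun N hN => ?_⟩
    rw [map_add, map_add, ha N (le_trans (le_max_left _ _) hN),
      hb N (le_trans (le_max_right _ _) hN)]
  | single p c =>
    obtain ⟨n, m⟩ := p
    exact ⟨n + 1, fun N hN => O_s hq n m c N (by omega)⟩

theorem A_pow_comm {q : ℂ} {Z : E} (h2 : Aop q * Z = (q⁻¹ ^ 2) • (Z * Aop q)) (k : ℕ) :
    Aop q ^ k * Z = ((q⁻¹ ^ 2) ^ k) • (Z * Aop q ^ k) := by
  induction k with
  | zero => simp
  | succ k ih =>
    rw [pow_succ', mul_assoc, ih, mul_smul_comm, ← mul_assoc, h2, smul_mul_assoc, smul_smul,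
      mul_assoc, ← pow_succ', ← pow_succ]

theorem X_pow {q : ℂ} (hq : q ≠ 0) (hroot : ∀ n : ℕ, n ≠ 0 → q ^ n ≠ 1) {X Z : E}
    (h1 : X * Aop q = Aop q * X + Z)
    (h2 : Aop q * Z = (q⁻¹ ^ 2) • (Z * Aop q)) (k : ℕ) :
    X * Aop q ^ (k + 1) = Aop q ^ (k + 1) * X + pnum (q⁻¹ ^ 2) (k + 1) • (Z * Aop q ^ k) := by
  induction k with
  | zero =>
    rw [pnum_succ hq hroot]
    simp [pnum, h1]
  | succ k ih =>
    rw [pow_succ, ← mul_assoc, ih, add_mul, mul_assoc, h1, mul_add, ← mul_assoc, ← pow_succ,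
      A_pow_comm h2, smul_mul_assoc, mul_assoc, ← pow_succ, pnum_succ hq hroot (k + 1), add_smul,
      add_assoc, add_comm (_ • _)]

/-- The key commutation lemma for the q-exponential. -/
theorem X_O {q : ℂ} (hq : q ≠ 0) (hroot : ∀ n : ℕ, n ≠ 0 → q ^ n ≠ 1) {X Z : E}
    (h1 : X * Aop q = Aop q * X + Z)
    (h2 : Aop q * Z = (q⁻¹ ^ 2) • (Z * Aop q)) :
    X * Oop q = Oop q * X + Z * Oop q := by
  have key : ∀ N, X * ON q (N + 1) = ON q (N + 1) * X + Z * ON q N := by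
    intro N
    rw [ON, ON, Finset.sum_range_succ', mul_add, add_mul, Finset.mul_sum, Finset.sum_mul,
      Finset.mul_sum]
    simp only [mul_smul_comm, smul_mul_assoc, X_pow hq hroot h1 h2, smul_add, smul_smul,
      r_succ hroot, Finset.sum_add_distrib, pow_zero, mul_one, one_mul]
    abel
  apply LinearMap.ext
  intro v
  obtain ⟨a, ha⟩ := O_eventually hq v
  obtain ⟨b, hb⟩ := O_eventually hq (X v)
  have hk := LinearMap.congr_fun (key (max a b)) v
  simp only [Module.End.mul_apply, LinearMap.add_apply] at hk ⊢
  rw [hb (max a b + 1) (by omega)]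
  rw [← ha (max a b + 1) (by omega), ← ha (max a b) (by omega)] at hk
  exact hk


set_option linter.all false

theorem A_pow_s {q : ℂ} (hq : q ≠ 0) (k : ℕ) : ∀ (n m : ℕ) (c : ℂ), ∃ c' : ℂ,
    (Aop q ^ k) (Finsupp.single (n, m) c) = Finsupp.single (n - k, m + k) c' := by
  induction k with
  | zero => intro n m c; exact ⟨c, by simp⟩
  | succ k ih =>
    intro n m c
    rw [pow_succ, Module.End.mul_apply, A_s hq]
    obtain ⟨c', h⟩ := ih (n - 1) (m + 1) (c * (q * (1 - (q ^ n)⁻¹ ^ 2) / (q - q⁻¹)))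
    refine ⟨c', ?_⟩
    rw [h]
    congr 2 <;> omega

theorem D_pow {q : ℂ} (hq : q ≠ 0) (n : ℕ) : ∀ (m : ℕ) (c : ℂ) (k : ℕ), n < k →
    ((1 - Oop q) ^ k) (Finsupp.single (n, m) c) = 0 := by
  induction n using Nat.strong_induction_on with
  | _ n ih =>
    intro m c k hk
    obtain ⟨k, rfl⟩ : ∃ j, k = j + 1 := ⟨k - 1, by omega⟩
    rw [pow_succ, Module.End.mul_apply, LinearMap.sub_apply, O_s hq n m c (n + 1) (by omega), ON,
      Finset.sum_range_succ']
    have hr : r q 0 = 1 := by simp [r, pfact]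
    simp only [hr, pow_zero, one_smul, LinearMap.add_apply, Module.End.one_apply, sub_add_cancel_right,
      map_neg, LinearMap.sum_apply, LinearMap.smul_apply, map_sum, map_smul]
    rw [neg_eq_zero]
    apply Finset.sum_eq_zero
    intro i hi
    rw [Finset.mem_range] at hi
    obtain ⟨c', h⟩ := A_pow_s hq (i + 1) n m c
    rw [h, ih _ (by omega) _ _ _ (by omega), smul_zero]

theorem D_eventually {q : ℂ} (hq : q ≠ 0) (v : V) :
    ∃ N0, ∀ N, N0 ≤ N → ((1 - Oop q : E) ^ N) v = 0 := by
  induction v using Finsupp.induction_linear with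
  | zero => exact ⟨0, fun N _ => by simp⟩
  | add f g hf hg =>
    obtain ⟨a, ha⟩ := hf
    obtain ⟨b, hb⟩ := hg
    refine ⟨max a b, fun N hN => ?_⟩
    rw [map_add, ha N (le_trans (le_max_left _ _) hN),
      hb N (le_trans (le_max_right _ _) hN), add_zero]
  | single p c =>
    obtain ⟨n, m⟩ := p
    exact ⟨n + 1, fun N hN => D_pow hq n m c N (by omega)⟩

theorem O_inv {q : ℂ} (hq : q ≠ 0) : ∃ Oinv : E, Oop q * Oinv = 1 ∧ Oinv * Oop q = 1 := by
  have h : IsUnit (Oop q) := by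
    rw [Module.End.isUnit_iff]
    constructor
    · rw [injective_iff_map_eq_zero]
      intro v hv
      obtain ⟨N, hN⟩ := D_eventually hq v
      have hfix : ∀ k : ℕ, ((1 - Oop q : E) ^ k) v = v := by
        intro k
        induction k with
        | zero => simp
        | succ k ih =>
          rw [pow_succ, Module.End.mul_apply, LinearMap.sub_apply, hv]
          simpa using ih
      rw [← hfix N, hN N le_rfl]
    · intro v
      obtain ⟨N, hN⟩ := D_eventually hq v
      refine ⟨(∑ i ∈ Finset.range N, (1 - Oop q) ^ i) v, ?_⟩
      have := mul_neg_geom_sum (1 - Oop q : E) N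
      rw [show (1 - (1 - Oop q) : E) = Oop q from sub_sub_cancel (1 : E) (Oop q)] at this
      rw [← Module.End.mul_apply, this, LinearMap.sub_apply, hN N le_rfl]
      simp
  obtain ⟨w, hw⟩ := h
  exact ⟨↑w⁻¹, by rw [← hw]; simp, by rw [← hw]; simp⟩


theorem basic10 {q : ℂ} (hq : q ≠ 0) (hroot : ∀ n : ℕ, n ≠ 0 → q ^ n ≠ 1) :
    (e1 q * Aop q = Aop q * e1 q + 0) ∧
    (f2 * Aop q = Aop q * f2 + 0) ∧
    (kh1 q * kh2 q * Aop q = Aop q * (kh1 q * kh2 q) + 0) ∧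
    (kh1i q * kh2i q * Aop q = Aop q * (kh1i q * kh2i q) + 0) ∧
    (f1 * Aop q = Aop q * f1 + -(f2 * kh1 q * kh1 q)) ∧
    (Aop q * -(f2 * kh1 q * kh1 q) = (q⁻¹ ^ 2) • (-(f2 * kh1 q * kh1 q) * Aop q)) ∧
    (Aop q * -(kh2i q * kh2i q * e1 q) = (q⁻¹ ^ 2) • (-(kh2i q * kh2i q * e1 q) * Aop q)) ∧
    (kh1 q * kh1 q * Aop q = Aop q * (kh1 q * kh1 q) + (1 - q⁻¹ ^ 2) • (kh1 q * kh1 q * Aop q)) ∧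
    (((q - q⁻¹) * (q - q⁻¹)) • (e1 q * kh1 q * (f2 * kh2i q)) = q⁻¹ • (((1 - q⁻¹ ^ 2) • (kh1 q * kh1 q * Aop q)) * (kh1i q * kh2i q))) ∧
    (e1 q * kh1 q * kh2i q = (kh2i q * kh2i q * e1 q) * (kh1 q * kh2 q)) ∧
    ((kh1i q * kh1i q) * (kh2i q * kh2i q * e1 q) = (kh1i q * kh2i q) * (kh1i q * kh2i q) * e1 q) ∧
    (((q - q⁻¹) * (q - q⁻¹)) • (f1 * ((kh1i q * kh2i q) * (kh1i q * kh2i q) * e1 q) * (kh1 q * kh2 q)) = q⁻¹ • (kh1i q * kh2i q) - q⁻¹ • (kh1 q * kh2i q)) := by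
  have hl' := lam_ne' hroot
  refine ⟨?_, ?_, ?_, ?_, ?_, ?_, ?_, ?_, ?_, ?_, ?_, ?_⟩ <;>
    (apply E_ext
     intro n m
     rcases n with _ | n <;>
     simp only [Module.End.mul_apply, Module.End.one_apply, LinearMap.add_apply, LinearMap.sub_apply, LinearMap.neg_apply,
       LinearMap.smul_apply, LinearMap.zero_apply, map_neg, map_add, map_zero, map_smul,
       e1_s hq, e2_s hq, f1_s, f2_s, kh1_s, kh1i_s, kh2_s, kh2i_s, A_s hq, smul_eq_mul,
       ← Finsupp.single_add, ← Finsupp.single_sub, ← Finsupp.single_neg, Finsupp.smul_single,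
       add_zero, zero_add, sub_zero, zero_sub, Nat.add_sub_cancel, pow_zero, inv_one, one_pow, sub_self, mul_zero, zero_mul,
       zero_div, Finsupp.single_zero, neg_zero, Nat.zero_sub, smul_zero] <;>
     first
     | done
     | (refine congrArg (Finsupp.single _) ?_
        try simp only [pow_succ]
        field_simp
        try ring)
     | (refine (Finsupp.single_eq_zero.mpr ?_).symm
        try simp only [pow_succ]
        field_simp
        try ring))

theorem A_comm_e1 {q : ℂ} (hq : q ≠ 0) (hroot : ∀ n : ℕ, n ≠ 0 → q ^ n ≠ 1) :
    e1 q * Aop q = Aop q * e1 q + 0 :=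
  (basic10 hq hroot).1

theorem A_comm_f2 {q : ℂ} (hq : q ≠ 0) (hroot : ∀ n : ℕ, n ≠ 0 → q ^ n ≠ 1) :
    f2 * Aop q = Aop q * f2 + 0 :=
  (basic10 hq hroot).2.1

theorem A_comm_K {q : ℂ} (hq : q ≠ 0) (hroot : ∀ n : ℕ, n ≠ 0 → q ^ n ≠ 1) :
    kh1 q * kh2 q * Aop q = Aop q * (kh1 q * kh2 q) + 0 :=
  (basic10 hq hroot).2.2.1

theorem A_comm_Ki {q : ℂ} (hq : q ≠ 0) (hroot : ∀ n : ℕ, n ≠ 0 → q ^ n ≠ 1) :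
    kh1i q * kh2i q * Aop q = Aop q * (kh1i q * kh2i q) + 0 :=
  (basic10 hq hroot).2.2.2.1

theorem bf1 {q : ℂ} (hq : q ≠ 0) (hroot : ∀ n : ℕ, n ≠ 0 → q ^ n ≠ 1) :
    f1 * Aop q = Aop q * f1 + -(f2 * kh1 q * kh1 q) :=
  (basic10 hq hroot).2.2.2.2.1

theorem bf1' {q : ℂ} (hq : q ≠ 0) (hroot : ∀ n : ℕ, n ≠ 0 → q ^ n ≠ 1) :
    Aop q * -(f2 * kh1 q * kh1 q) = (q⁻¹ ^ 2) • (-(f2 * kh1 q * kh1 q) * Aop q) :=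
  (basic10 hq hroot).2.2.2.2.2.1

theorem be2' {q : ℂ} (hq : q ≠ 0) (hroot : ∀ n : ℕ, n ≠ 0 → q ^ n ≠ 1) :
    Aop q * -(kh2i q * kh2i q * e1 q) = (q⁻¹ ^ 2) • (-(kh2i q * kh2i q * e1 q) * Aop q) :=
  (basic10 hq hroot).2.2.2.2.2.2.1

theorem bk {q : ℂ} (hq : q ≠ 0) (hroot : ∀ n : ℕ, n ≠ 0 → q ^ n ≠ 1) :
    kh1 q * kh1 q * Aop q = Aop q * (kh1 q * kh1 q) + (1 - q⁻¹ ^ 2) • (kh1 q * kh1 q * Aop q) :=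
  (basic10 hq hroot).2.2.2.2.2.2.2.1

theorem i22 {q : ℂ} (hq : q ≠ 0) (hroot : ∀ n : ℕ, n ≠ 0 → q ^ n ≠ 1) :
    ((q - q⁻¹) * (q - q⁻¹)) • (e1 q * kh1 q * (f2 * kh2i q)) = q⁻¹ • (((1 - q⁻¹ ^ 2) • (kh1 q * kh1 q * Aop q)) * (kh1i q * kh2i q)) :=
  (basic10 hq hroot).2.2.2.2.2.2.2.2.1

theorem i21b1 {q : ℂ} (hq : q ≠ 0) (hroot : ∀ n : ℕ, n ≠ 0 → q ^ n ≠ 1) :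
    e1 q * kh1 q * kh2i q = (kh2i q * kh2i q * e1 q) * (kh1 q * kh2 q) :=
  (basic10 hq hroot).2.2.2.2.2.2.2.2.2.1

theorem i2 {q : ℂ} (hq : q ≠ 0) (hroot : ∀ n : ℕ, n ≠ 0 → q ^ n ≠ 1) :
    (kh1i q * kh1i q) * (kh2i q * kh2i q * e1 q) = (kh1i q * kh2i q) * (kh1i q * kh2i q) * e1 q :=
  (basic10 hq hroot).2.2.2.2.2.2.2.2.2.2.1

theorem j2 {q : ℂ} (hq : q ≠ 0) (hroot : ∀ n : ℕ, n ≠ 0 → q ^ n ≠ 1) :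
    ((q - q⁻¹) * (q - q⁻¹)) • (f1 * ((kh1i q * kh2i q) * (kh1i q * kh2i q) * e1 q) * (kh1 q * kh2 q)) = q⁻¹ • (kh1i q * kh2i q) - q⁻¹ • (kh1 q * kh2i q) :=
  (basic10 hq hroot).2.2.2.2.2.2.2.2.2.2.2

theorem basic11 {q : ℂ} (hq : q ≠ 0) (hroot : ∀ n : ℕ, n ≠ 0 → q ^ n ≠ 1) :
    (e2 q * Aop q = Aop q * e2 q + -(kh2i q * kh2i q * e1 q)) ∧
    ((kh1i q * kh2i q) * (kh1i q * kh2i q) * e1 q + (1 - q⁻¹ ^ 2) • (Aop q * (kh1i q * kh1i q) * e2 q) = (kh1i q * kh1i q) * e1 q) ∧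
    (-((((q - q⁻¹) * (q - q⁻¹)) * (q⁻¹ ^ 2) * (1 - q⁻¹ ^ 2)) • (Aop q * (kh1i q * kh1i q) * f1 * e2 q * (kh1 q * kh2 q))) - (((q - q⁻¹) * (q - q⁻¹)) * (q⁻¹ ^ 2)) • (f2 * e2 q * (kh1 q * kh2 q)) - q⁻¹ • (kh1i q * kh2i q) = -(q⁻¹ • (kh1i q * kh2 q))) := by
  have hl' := lam_ne' hroot
  refine ⟨?_, ?_, ?_⟩ <;>
    (apply E_ext
     intro n m
     rcases n with _ | n <;>
     rcases m with _ | m <;>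
     simp only [Module.End.mul_apply, Module.End.one_apply, LinearMap.add_apply, LinearMap.sub_apply, LinearMap.neg_apply,
       LinearMap.smul_apply, LinearMap.zero_apply, map_neg, map_add, map_zero, map_smul,
       e1_s hq, e2_s hq, f1_s, f2_s, kh1_s, kh1i_s, kh2_s, kh2i_s, A_s hq, smul_eq_mul,
       ← Finsupp.single_add, ← Finsupp.single_sub, ← Finsupp.single_neg, Finsupp.smul_single,
       add_zero, zero_add, sub_zero, zero_sub, Nat.add_sub_cancel, pow_zero, inv_one, one_pow, sub_self, mul_zero, zero_mul,
       zero_div, Finsupp.single_zero, neg_zero, Nat.zero_sub, smul_zero] <;>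
     first
     | done
     | (refine congrArg (Finsupp.single _) ?_
        try simp only [pow_succ]
        field_simp
        try ring)
     | (refine (Finsupp.single_eq_zero.mpr ?_).symm
        try simp only [pow_succ]
        field_simp
        try ring))

theorem be2 {q : ℂ} (hq : q ≠ 0) (hroot : ∀ n : ℕ, n ≠ 0 → q ^ n ≠ 1) :
    e2 q * Aop q = Aop q * e2 q + -(kh2i q * kh2i q * e1 q) :=
  (basic11 hq hroot).1

theorem i3 {q : ℂ} (hq : q ≠ 0) (hroot : ∀ n : ℕ, n ≠ 0 → q ^ n ≠ 1) :
    (kh1i q * kh2i q) * (kh1i q * kh2i q) * e1 q + (1 - q⁻¹ ^ 2) • (Aop q * (kh1i q * kh1i q) * e2 q) = (kh1i q * kh1i q) * e1 q :=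
  (basic11 hq hroot).2.1

theorem j3 {q : ℂ} (hq : q ≠ 0) (hroot : ∀ n : ℕ, n ≠ 0 → q ^ n ≠ 1) :
    -((((q - q⁻¹) * (q - q⁻¹)) * (q⁻¹ ^ 2) * (1 - q⁻¹ ^ 2)) • (Aop q * (kh1i q * kh1i q) * f1 * e2 q * (kh1 q * kh2 q))) - (((q - q⁻¹) * (q - q⁻¹)) * (q⁻¹ ^ 2)) • (f2 * e2 q * (kh1 q * kh2 q)) - q⁻¹ • (kh1i q * kh2i q) = -(q⁻¹ • (kh1i q * kh2 q)) :=
  (basic11 hq hroot).2.2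

theorem bk' {q : ℂ} (hq : q ≠ 0) (hroot : ∀ n : ℕ, n ≠ 0 → q ^ n ≠ 1) :
    Aop q * ((1 - q⁻¹ ^ 2) • (kh1 q * kh1 q * Aop q)) = (q⁻¹ ^ 2) • (((1 - q⁻¹ ^ 2) • (kh1 q * kh1 q * Aop q)) * Aop q) := by
  have hl' := lam_ne' hroot
  apply E_ext
  intro n m
  rcases n with _ | _ | n <;>
  simp only [Module.End.mul_apply, LinearMap.add_apply, LinearMap.sub_apply, LinearMap.neg_apply,
    LinearMap.smul_apply, LinearMap.zero_apply, map_neg, map_add, map_zero, map_smul,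
    e1_s hq, e2_s hq, f1_s, f2_s, kh1_s, kh1i_s, kh2_s, kh2i_s, A_s hq, smul_eq_mul,
    ← Finsupp.single_add, ← Finsupp.single_sub, ← Finsupp.single_neg, Finsupp.smul_single,
    add_zero, zero_add, sub_zero, zero_sub, Nat.add_sub_cancel, pow_zero, inv_one, one_pow, sub_self, mul_zero, zero_mul,
    zero_div, Finsupp.single_zero, neg_zero, Nat.zero_sub, smul_zero] <;>
  first
  | done
  | (refine congrArg (Finsupp.single _) ?_
     try simp only [pow_succ]
     field_simp
     try ring)
  | (refine (Finsupp.single_eq_zero.mpr ?_).symm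
     try simp only [pow_succ]
     field_simp
     try ring)

theorem basic00 {q : ℂ} (hq : q ≠ 0) (hroot : ∀ n : ℕ, n ≠ 0 → q ^ n ≠ 1) :
    (kh1 q * kh1 q * (kh1i q * kh1i q) = 1) ∧
    ((kh1i q * kh1i q) * (kh1 q * kh1 q) = 1) ∧
    (kh1 q * (f2 * kh2i q) = (f2 * kh1 q * kh1 q) * (kh1i q * kh2i q)) ∧
    (kh1 q * kh2i q = kh1 q * kh1 q * (kh1i q * kh2i q)) ∧
    (f1 * (kh1i q * kh1i q) = q⁻¹ ^ 2 • ((kh1i q * kh1i q) * f1)) ∧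
    ((kh1i q * kh1i q) * (f2 * kh1 q * kh1 q) = f2) := by
  have hl' := lam_ne' hroot
  refine ⟨?_, ?_, ?_, ?_, ?_, ?_⟩ <;>
    (apply E_ext
     intro n m
     simp only [Module.End.mul_apply, Module.End.one_apply, LinearMap.add_apply, LinearMap.sub_apply, LinearMap.neg_apply,
       LinearMap.smul_apply, LinearMap.zero_apply, map_neg, map_add, map_zero, map_smul,
       e1_s hq, e2_s hq, f1_s, f2_s, kh1_s, kh1i_s, kh2_s, kh2i_s, A_s hq, smul_eq_mul,
       ← Finsupp.single_add, ← Finsupp.single_sub, ← Finsupp.single_neg, Finsupp.smul_single,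
       add_zero, zero_add, sub_zero, zero_sub, Nat.add_sub_cancel, pow_zero, inv_one, one_pow, sub_self, mul_zero, zero_mul,
       zero_div, Finsupp.single_zero, neg_zero, Nat.zero_sub, smul_zero] <;>
     first
     | done
     | (refine congrArg (Finsupp.single _) ?_
        try simp only [pow_succ]
        field_simp
        try ring)
     | (refine (Finsupp.single_eq_zero.mpr ?_).symm
        try simp only [pow_succ]
        field_simp
        try ring))

theorem k1T {q : ℂ} (hq : q ≠ 0) (hroot : ∀ n : ℕ, n ≠ 0 → q ^ n ≠ 1) :
    kh1 q * kh1 q * (kh1i q * kh1i q) = 1 :=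
  (basic00 hq hroot).1

theorem Tk1 {q : ℂ} (hq : q ≠ 0) (hroot : ∀ n : ℕ, n ≠ 0 → q ^ n ≠ 1) :
    (kh1i q * kh1i q) * (kh1 q * kh1 q) = 1 :=
  (basic00 hq hroot).2.1

theorem i12 {q : ℂ} (hq : q ≠ 0) (hroot : ∀ n : ℕ, n ≠ 0 → q ^ n ≠ 1) :
    kh1 q * (f2 * kh2i q) = (f2 * kh1 q * kh1 q) * (kh1i q * kh2i q) :=
  (basic00 hq hroot).2.2.1

theorem i22b {q : ℂ} (hq : q ≠ 0) (hroot : ∀ n : ℕ, n ≠ 0 → q ^ n ≠ 1) :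
    kh1 q * kh2i q = kh1 q * kh1 q * (kh1i q * kh2i q) :=
  (basic00 hq hroot).2.2.2.1

theorem j1 {q : ℂ} (hq : q ≠ 0) (hroot : ∀ n : ℕ, n ≠ 0 → q ^ n ≠ 1) :
    f1 * (kh1i q * kh1i q) = q⁻¹ ^ 2 • ((kh1i q * kh1i q) * f1) :=
  (basic00 hq hroot).2.2.2.2.1

theorem j4 {q : ℂ} (hq : q ≠ 0) (hroot : ∀ n : ℕ, n ≠ 0 → q ^ n ≠ 1) :
    (kh1i q * kh1i q) * (f2 * kh1 q * kh1 q) = f2 :=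
  (basic00 hq hroot).2.2.2.2.2

theorem basic01 {q : ℂ} (hq : q ≠ 0) (hroot : ∀ n : ℕ, n ≠ 0 → q ^ n ≠ 1) :
    (kh1 q * (e2 q * kh2 q) = e2 q * (kh1 q * kh2 q)) ∧
    (kh1i q * (e2 q * kh2 q) = (kh1i q * kh1i q) * e2 q * (kh1 q * kh2 q)) := by
  have hl' := lam_ne' hroot
  refine ⟨?_, ?_⟩ <;>
    (apply E_ext
     intro n m
     rcases m with _ | m <;>
     simp only [Module.End.mul_apply, Module.End.one_apply, LinearMap.add_apply, LinearMap.sub_apply, LinearMap.neg_apply,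
       LinearMap.smul_apply, LinearMap.zero_apply, map_neg, map_add, map_zero, map_smul,
       e1_s hq, e2_s hq, f1_s, f2_s, kh1_s, kh1i_s, kh2_s, kh2i_s, A_s hq, smul_eq_mul,
       ← Finsupp.single_add, ← Finsupp.single_sub, ← Finsupp.single_neg, Finsupp.smul_single,
       add_zero, zero_add, sub_zero, zero_sub, Nat.add_sub_cancel, pow_zero, inv_one, one_pow, sub_self, mul_zero, zero_mul,
       zero_div, Finsupp.single_zero, neg_zero, Nat.zero_sub, smul_zero] <;>
     first
     | done
     | (refine congrArg (Finsupp.single _) ?_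
        try simp only [pow_succ]
        field_simp
        try ring)
     | (refine (Finsupp.single_eq_zero.mpr ?_).symm
        try simp only [pow_succ]
        field_simp
        try ring))

theorem i21b2 {q : ℂ} (hq : q ≠ 0) (hroot : ∀ n : ℕ, n ≠ 0 → q ^ n ≠ 1) :
    kh1 q * (e2 q * kh2 q) = e2 q * (kh1 q * kh2 q) :=
  (basic01 hq hroot).1

theorem i1 {q : ℂ} (hq : q ≠ 0) (hroot : ∀ n : ℕ, n ≠ 0 → q ^ n ≠ 1) :
    kh1i q * (e2 q * kh2 q) = (kh1i q * kh1i q) * e2 q * (kh1 q * kh2 q) :=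
  (basic01 hq hroot).2

theorem rK {q : ℂ} (hq : q ≠ 0) (hroot : ∀ n : ℕ, n ≠ 0 → q ^ n ≠ 1) :
    (kh1 q * kh2 q) * Oop q = Oop q * (kh1 q * kh2 q) := by
  have h := X_O hq hroot (A_comm_K hq hroot) (by simp)
  rwa [zero_mul, add_zero] at h

theorem rKi {q : ℂ} (hq : q ≠ 0) (hroot : ∀ n : ℕ, n ≠ 0 → q ^ n ≠ 1) :
    (kh1i q * kh2i q) * Oop q = Oop q * (kh1i q * kh2i q) := by
  have h := X_O hq hroot (A_comm_Ki hq hroot) (by simp)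
  rwa [zero_mul, add_zero] at h

theorem re1 {q : ℂ} (hq : q ≠ 0) (hroot : ∀ n : ℕ, n ≠ 0 → q ^ n ≠ 1) :
    e1 q * Oop q = Oop q * e1 q := by
  have h := X_O hq hroot (A_comm_e1 hq hroot) (by simp)
  rwa [zero_mul, add_zero] at h

theorem rf2 {q : ℂ} (hq : q ≠ 0) (hroot : ∀ n : ℕ, n ≠ 0 → q ^ n ≠ 1) :
    f2 * Oop q = Oop q * f2 := by
  have h := X_O hq hroot (A_comm_f2 hq hroot) (by simp)
  rwa [zero_mul, add_zero] at h

theorem A_comm_A (q : ℂ) : Aop q * Aop q = Aop q * Aop q + 0 := by simp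

theorem rA {q : ℂ} (hq : q ≠ 0) (hroot : ∀ n : ℕ, n ≠ 0 → q ^ n ≠ 1) :
    Aop q * Oop q = Oop q * Aop q := by
  have h := X_O hq hroot (A_comm_A q) (by simp)
  rwa [zero_mul, add_zero] at h

theorem R1 {q : ℂ} (hq : q ≠ 0) (hroot : ∀ n : ℕ, n ≠ 0 → q ^ n ≠ 1) :
    f1 * Oop q = Oop q * f1 + (-(f2 * kh1 q * kh1 q)) * Oop q := by
  have h := X_O hq hroot (bf1 hq hroot) (bf1' hq hroot)
  exact h

theorem R4 {q : ℂ} (hq : q ≠ 0) (hroot : ∀ n : ℕ, n ≠ 0 → q ^ n ≠ 1) :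
    e2 q * Oop q = Oop q * e2 q + (-(kh2i q * kh2i q * e1 q)) * Oop q := by
  have h := X_O hq hroot (be2 hq hroot) (be2' hq hroot)
  exact h

theorem R3 {q : ℂ} (hq : q ≠ 0) (hroot : ∀ n : ℕ, n ≠ 0 → q ^ n ≠ 1) :
    (kh1 q * kh1 q) * Oop q = Oop q * (kh1 q * kh1 q) + ((1 - q⁻¹ ^ 2) • (kh1 q * kh1 q * Aop q)) * Oop q := by
  have h := X_O hq hroot (bk hq hroot) (bk' hq hroot)
  exact h

theorem g_R3T {R : Type*} [Ring R] [Algebra ℂ R] (q : ℂ) (k1 k2 k1i k2i e1 e2 f1 f2 A O : R)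
    (h_R3 : (k1 * k1) * O = O * (k1 * k1) + ((1 - q⁻¹ ^ 2) • (k1 * k1 * A)) * O)
    (h_k1T : k1 * k1 * (k1i * k1i) = 1)
    (h_Tk1 : (k1i * k1i) * (k1 * k1) = 1)
    : (k1i * k1i) * O = O * (k1i * k1i) - (1 - q⁻¹ ^ 2) • (A * O * (k1i * k1i)) := by
  linear_combination (norm := (simp only [mul_add, add_mul, mul_sub, sub_mul, mul_assoc, smul_mul_assoc, mul_smul_comm,
    neg_mul, mul_neg, smul_add, smul_sub, smul_neg, smul_smul, mul_one, one_mul]; module))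
    - ((k1i * k1i) * h_R3 * (k1i * k1i)) - (k1i * k1i) * O * h_k1T + h_Tk1 * O * (k1i * k1i) - (1 - q⁻¹ ^ 2) • (h_Tk1 * A * O * (k1i * k1i))

theorem R3T {q : ℂ} (hq : q ≠ 0) (hroot : ∀ n : ℕ, n ≠ 0 → q ^ n ≠ 1) :
    (kh1i q * kh1i q) * Oop q = Oop q * (kh1i q * kh1i q) - (1 - q⁻¹ ^ 2) • (Aop q * Oop q * (kh1i q * kh1i q)) :=
  g_R3T (R := E) q (kh1 q) (kh2 q) (kh1i q) (kh2i q) (e1 q) (e2 q) f1 f2 (Aop q) (Oop q)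
    (R3 hq hroot) (k1T hq hroot) (Tk1 hq hroot)

theorem g_E12 {R : Type*} [Ring R] [Algebra ℂ R] (q : ℂ) (k1 k2 k1i k2i e1 e2 f1 f2 A O : R)
    (h_i12 : k1 * (f2 * k2i) = (f2 * k1 * k1) * (k1i * k2i))
    (h_rKi : (k1i * k2i) * O = O * (k1i * k2i))
    (h_R1 : f1 * O = O * f1 + (-(f2 * k1 * k1)) * O)
    : (k1 * (f2 * k2i) + f1 * k1i * k2i) * O = O * (f1 * k1i * k2i) := by
  linear_combination (norm := (simp only [mul_add, add_mul, mul_sub, sub_mul, mul_assoc, smul_mul_assoc, mul_smul_comm,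
    neg_mul, mul_neg, smul_add, smul_sub, smul_neg, smul_smul, mul_one, one_mul]; module))
    h_i12 * O + ((f2 * k1 * k1) + f1) * h_rKi + h_R1 * (k1i * k2i)

theorem E12 {q : ℂ} (hq : q ≠ 0) (hroot : ∀ n : ℕ, n ≠ 0 → q ^ n ≠ 1) :
    (kh1 q * (f2 * kh2i q) + f1 * kh1i q * kh2i q) * Oop q = Oop q * (f1 * kh1i q * kh2i q) :=
  g_E12 (R := E) q (kh1 q) (kh2 q) (kh1i q) (kh2i q) (e1 q) (e2 q) f1 f2 (Aop q) (Oop q)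
    (i12 hq hroot) (rKi hq hroot) (R1 hq hroot)

theorem g_E22 {R : Type*} [Ring R] [Algebra ℂ R] (q : ℂ) (k1 k2 k1i k2i e1 e2 f1 f2 A O : R)
    (h_i22 : ((q - q⁻¹) * (q - q⁻¹)) • (e1 * k1 * (f2 * k2i)) = q⁻¹ • (((1 - q⁻¹ ^ 2) • (k1 * k1 * A)) * (k1i * k2i)))
    (h_i22b : k1 * k2i = k1 * k1 * (k1i * k2i))
    (h_rKi : (k1i * k2i) * O = O * (k1i * k2i))
    (h_R3 : (k1 * k1) * O = O * (k1 * k1) + ((1 - q⁻¹ ^ 2) • (k1 * k1 * A)) * O)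
    : (((q - q⁻¹) * (q - q⁻¹)) • (e1 * k1 * (f2 * k2i)) - q⁻¹ • (k1 * k2i)) * O = O * (-(q⁻¹ • (k1 * k2i))) := by
  linear_combination (norm := (simp only [mul_add, add_mul, mul_sub, sub_mul, mul_assoc, smul_mul_assoc, mul_smul_comm,
    neg_mul, mul_neg, smul_add, smul_sub, smul_neg, smul_smul, mul_one, one_mul]; module))
    h_i22 * O - q⁻¹ • (h_i22b * O) + q⁻¹ • ((((1 - q⁻¹ ^ 2) • (k1 * k1 * A)) - k1 * k1) * h_rKi) - q⁻¹ • (h_R3 * (k1i * k2i)) + q⁻¹ • (O * h_i22b)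

theorem E22 {q : ℂ} (hq : q ≠ 0) (hroot : ∀ n : ℕ, n ≠ 0 → q ^ n ≠ 1) :
    (((q - q⁻¹) * (q - q⁻¹)) • (e1 q * kh1 q * (f2 * kh2i q)) - q⁻¹ • (kh1 q * kh2i q)) * Oop q = Oop q * (-(q⁻¹ • (kh1 q * kh2i q))) :=
  g_E22 (R := E) q (kh1 q) (kh2 q) (kh1i q) (kh2i q) (e1 q) (e2 q) f1 f2 (Aop q) (Oop q)
    (i22 hq hroot) (i22b hq hroot) (rKi hq hroot) (R3 hq hroot)

theorem g_E21b {R : Type*} [Ring R] [Algebra ℂ R] (q : ℂ) (k1 k2 k1i k2i e1 e2 f1 f2 A O : R)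
    (h_i21b1 : e1 * k1 * k2i = (k2i * k2i * e1) * (k1 * k2))
    (h_i21b2 : k1 * (e2 * k2) = e2 * (k1 * k2))
    (h_rK : (k1 * k2) * O = O * (k1 * k2))
    (h_R4 : e2 * O = O * e2 + (-(k2i * k2i * e1)) * O)
    : (e1 * k1 * k2i + k1 * (e2 * k2)) * O = O * (k1 * (e2 * k2)) := by
  linear_combination (norm := (simp only [mul_add, add_mul, mul_sub, sub_mul, mul_assoc, smul_mul_assoc, mul_smul_comm,
    neg_mul, mul_neg, smul_add, smul_sub, smul_neg, smul_smul, mul_one, one_mul]; module))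
    h_i21b1 * O + h_i21b2 * O + ((k2i * k2i * e1) + e2) * h_rK + h_R4 * (k1 * k2) - O * h_i21b2

theorem E21b {q : ℂ} (hq : q ≠ 0) (hroot : ∀ n : ℕ, n ≠ 0 → q ^ n ≠ 1) :
    (e1 q * kh1 q * kh2i q + kh1 q * (e2 q * kh2 q)) * Oop q = Oop q * (kh1 q * (e2 q * kh2 q)) :=
  g_E21b (R := E) q (kh1 q) (kh2 q) (kh1i q) (kh2i q) (e1 q) (e2 q) f1 f2 (Aop q) (Oop q)
    (i21b1 hq hroot) (i21b2 hq hroot) (rK hq hroot) (R4 hq hroot)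

theorem g_E21a {R : Type*} [Ring R] [Algebra ℂ R] (q : ℂ) (k1 k2 k1i k2i e1 e2 f1 f2 A O : R)
    (h_i1 : k1i * (e2 * k2) = (k1i * k1i) * e2 * (k1 * k2))
    (h_i2 : (k1i * k1i) * (k2i * k2i * e1) = (k1i * k2i) * (k1i * k2i) * e1)
    (h_i3 : (k1i * k2i) * (k1i * k2i) * e1 + (1 - q⁻¹ ^ 2) • (A * (k1i * k1i) * e2) = (k1i * k1i) * e1)
    (h_rK : (k1 * k2) * O = O * (k1 * k2))
    (h_rKi : (k1i * k2i) * O = O * (k1i * k2i))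
    (h_re1 : e1 * O = O * e1)
    (h_rA : A * O = O * A)
    (h_R4 : e2 * O = O * e2 + (-(k2i * k2i * e1)) * O)
    (h_R3T : (k1i * k1i) * O = O * (k1i * k1i) - (1 - q⁻¹ ^ 2) • (A * O * (k1i * k1i)))
    : k1i * (e2 * k2) * O = O * (k1i * (e2 * k2) - (k1i * k1i) * e1 * (k1 * k2)) := by
  linear_combination (norm := (simp only [mul_add, add_mul, mul_sub, sub_mul, mul_assoc, smul_mul_assoc, mul_smul_comm,
    neg_mul, mul_neg, smul_add, smul_sub, smul_neg, smul_smul, mul_one, one_mul]; module))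
    h_i1 * O + (k1i * k1i) * e2 * h_rK + (k1i * k1i) * h_R4 * (k1 * k2) + h_R3T * e2 * (k1 * k2) - h_i2 * O * (k1 * k2) - (k1i * k2i) * (k1i * k2i) * h_re1 * (k1 * k2) - (k1i * k2i) * h_rKi * e1 * (k1 * k2) - h_rKi * (k1i * k2i) * e1 * (k1 * k2) - (1 - q⁻¹ ^ 2) • (h_rA * (k1i * k1i) * e2 * (k1 * k2)) - O * h_i3 * (k1 * k2) - O * h_i1

theorem E21a {q : ℂ} (hq : q ≠ 0) (hroot : ∀ n : ℕ, n ≠ 0 → q ^ n ≠ 1) :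
    kh1i q * (e2 q * kh2 q) * Oop q = Oop q * (kh1i q * (e2 q * kh2 q) - (kh1i q * kh1i q) * e1 q * (kh1 q * kh2 q)) :=
  g_E21a (R := E) q (kh1 q) (kh2 q) (kh1i q) (kh2i q) (e1 q) (e2 q) f1 f2 (Aop q) (Oop q)
    (i1 hq hroot) (i2 hq hroot) (i3 hq hroot) (rK hq hroot) (rKi hq hroot) (re1 hq hroot) (rA hq hroot) (R4 hq hroot) (R3T hq hroot)

theorem g_E11 {R : Type*} [Ring R] [Algebra ℂ R] (q : ℂ) (k1 k2 k1i k2i e1 e2 f1 f2 A O : R)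
    (h_i1 : k1i * (e2 * k2) = (k1i * k1i) * e2 * (k1 * k2))
    (h_i2 : (k1i * k1i) * (k2i * k2i * e1) = (k1i * k2i) * (k1i * k2i) * e1)
    (h_j1 : f1 * (k1i * k1i) = q⁻¹ ^ 2 • ((k1i * k1i) * f1))
    (h_j2 : ((q - q⁻¹) * (q - q⁻¹)) • (f1 * ((k1i * k2i) * (k1i * k2i) * e1) * (k1 * k2)) = q⁻¹ • (k1i * k2i) - q⁻¹ • (k1 * k2i))
    (h_j3 : -((((q - q⁻¹) * (q - q⁻¹)) * (q⁻¹ ^ 2) * (1 - q⁻¹ ^ 2)) • (A * (k1i * k1i) * f1 * e2 * (k1 * k2))) - (((q - q⁻¹) * (q - q⁻¹)) * (q⁻¹ ^ 2)) • (f2 * e2 * (k1 * k2)) - q⁻¹ • (k1i * k2i) = -(q⁻¹ • (k1i * k2)))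
    (h_j4 : (k1i * k1i) * (f2 * k1 * k1) = f2)
    (h_rK : (k1 * k2) * O = O * (k1 * k2))
    (h_rKi : (k1i * k2i) * O = O * (k1i * k2i))
    (h_rf2 : f2 * O = O * f2)
    (h_rA : A * O = O * A)
    (h_R1 : f1 * O = O * f1 + (-(f2 * k1 * k1)) * O)
    (h_R4 : e2 * O = O * e2 + (-(k2i * k2i * e1)) * O)
    (h_R3T : (k1i * k1i) * O = O * (k1i * k1i) - (1 - q⁻¹ ^ 2) • (A * O * (k1i * k1i)))
    : (((q - q⁻¹) * (q - q⁻¹)) • (f1 * k1i * (e2 * k2)) - q⁻¹ • (k1 * k2i)) * O = O * (((q - q⁻¹) * (q - q⁻¹)) • (f1 * k1i * (e2 * k2)) - q⁻¹ • (k1i * k2)) := by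
  linear_combination (norm := (simp only [mul_add, add_mul, mul_sub, sub_mul, mul_assoc, smul_mul_assoc, mul_smul_comm,
    neg_mul, mul_neg, smul_add, smul_sub, smul_neg, smul_smul, mul_one, one_mul]; module))
    ((q - q⁻¹) * (q - q⁻¹)) • (f1 * h_i1 * O) + ((q - q⁻¹) * (q - q⁻¹)) • (f1 * (k1i * k1i) * e2 * h_rK) + ((q - q⁻¹) * (q - q⁻¹)) • (f1 * (k1i * k1i) * h_R4 * (k1 * k2)) - ((q - q⁻¹) * (q - q⁻¹)) • (f1 * h_i2 * O * (k1 * k2)) + ((q - q⁻¹) * (q - q⁻¹)) • (f1 * ((k1i * k2i) * (k1i * k2i) * e1) * h_rK) - h_j2 * O - q⁻¹ • h_rKi + ((q - q⁻¹) * (q - q⁻¹)) • (h_j1 * O * e2 * (k1 * k2)) + (((q - q⁻¹) * (q - q⁻¹)) * (q⁻¹ ^ 2)) • ((k1i * k1i) * h_R1 * e2 * (k1 * k2)) - (((q - q⁻¹) * (q - q⁻¹)) * (q⁻¹ ^ 2)) • (h_j4 * O * e2 * (k1 * k2)) - (((q - q⁻¹) * (q - q⁻¹)) * (q⁻¹ ^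 2)) • (h_rf2 * e2 * (k1 * k2)) + (((q - q⁻¹) * (q - q⁻¹)) * (q⁻¹ ^ 2)) • (h_R3T * f1 * e2 * (k1 * k2)) - (((q - q⁻¹) * (q - q⁻¹)) * (q⁻¹ ^ 2) * (1 - q⁻¹ ^ 2)) • (h_rA * (k1i * k1i) * f1 * e2 * (k1 * k2)) - ((q - q⁻¹) * (q - q⁻¹)) • (O * h_j1 * e2 * (k1 * k2)) + O * h_j3 - ((q - q⁻¹) * (q - q⁻¹)) • (O * f1 * h_i1)

theorem E11 {q : ℂ} (hq : q ≠ 0) (hroot : ∀ n : ℕ, n ≠ 0 → q ^ n ≠ 1) :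
    (((q - q⁻¹) * (q - q⁻¹)) • (f1 * kh1i q * (e2 q * kh2 q)) - q⁻¹ • (kh1 q * kh2i q)) * Oop q = Oop q * (((q - q⁻¹) * (q - q⁻¹)) • (f1 * kh1i q * (e2 q * kh2 q)) - q⁻¹ • (kh1i q * kh2 q)) :=
  g_E11 (R := E) q (kh1 q) (kh2 q) (kh1i q) (kh2i q) (e1 q) (e2 q) f1 f2 (Aop q) (Oop q)
    (i1 hq hroot) (i2 hq hroot) (j1 hq hroot) (j2 hq hroot) (j3 hq hroot) (j4 hq hroot) (rK hq hroot) (rKi hq hroot) (rf2 hq hroot) (rA hq hroot) (R1 hq hroot) (R4 hq hroot) (R3T hq hroot)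



theorem fin00 {R : Type*} [Ring R] [Algebra ℂ R] (q u x : ℂ) (hq : q ≠ 0) (hu : u ≠ 0) (k1 k2 k1i k2i e1 e2 f1 f2 O : R)
    (hK : k1 * k2 * O = O * (k1 * k2)) (hKi : k1i * k2i * O = O * (k1i * k2i)) (he1 : e1 * O = O * e1)
    (h : (((q - q⁻¹) * (q - q⁻¹)) • (f1 * k1i * (e2 * k2)) - q⁻¹ • (k1 * k2i)) * O
      = O * (((q - q⁻¹) * (q - q⁻¹)) • (f1 * k1i * (e2 * k2)) - q⁻¹ • (k1i * k2))) :
    (k1 * (k2 - (q⁻¹ * (x * u⁻¹ ^ 2)) • k2i) + ((q - q⁻¹) • (f1 * k1i)) * (((q - q⁻¹) * (x * u⁻¹ ^ 2)) • (e2 * k2))) * O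
      = O * (((u • k1 - (q⁻¹ * x * u⁻¹) • k1i) * (1 : R) + (((q - q⁻¹) * u⁻¹) • (f1 * k1i)) * (((q - q⁻¹) * x) • e2)) * (u⁻¹ • k2) + ((u • k1 - (q⁻¹ * x * u⁻¹) • k1i) * (0 : R) + (((q - q⁻¹) * u⁻¹) • (f1 * k1i)) * (1 : R)) * (0 : R)) := by
  linear_combination (norm := (simp only [mul_add, add_mul, mul_sub, sub_mul, mul_assoc, smul_mul_assoc, mul_smul_comm,
    neg_mul, mul_neg, smul_add, smul_sub, smul_neg, smul_smul, mul_one, one_mul, mul_zero, zero_mul,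
    smul_zero, add_zero, zero_add]; match_scalars <;> field_simp <;> try ring))
    hK + (x * u⁻¹ ^ 2) • h

theorem fin01 {R : Type*} [Ring R] [Algebra ℂ R] (q u x : ℂ) (hq : q ≠ 0) (hu : u ≠ 0) (k1 k2 k1i k2i e1 e2 f1 f2 O : R)
    (hK : k1 * k2 * O = O * (k1 * k2)) (hKi : k1i * k2i * O = O * (k1i * k2i)) (he1 : e1 * O = O * e1)
    (h : (k1 * (f2 * k2i) + f1 * k1i * k2i) * O = O * (f1 * k1i * k2i)) :
    (k1 * ((q - q⁻¹) • (f2 * k2i)) + ((q - q⁻¹) • (f1 * k1i)) * k2i) * O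
      = O * (((u • k1 - (q⁻¹ * x * u⁻¹) • k1i) * (1 : R) + (((q - q⁻¹) * u⁻¹) • (f1 * k1i)) * (((q - q⁻¹) * x) • e2)) * (0 : R) + ((u • k1 - (q⁻¹ * x * u⁻¹) • k1i) * (0 : R) + (((q - q⁻¹) * u⁻¹) • (f1 * k1i)) * (1 : R)) * (u • k2i)) := by
  linear_combination (norm := (simp only [mul_add, add_mul, mul_sub, sub_mul, mul_assoc, smul_mul_assoc, mul_smul_comm,
    neg_mul, mul_neg, smul_add, smul_sub, smul_neg, smul_smul, mul_one, one_mul, mul_zero, zero_mul,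
    smul_zero, add_zero, zero_add]; match_scalars <;> field_simp <;> try ring))
    (q - q⁻¹) • h

theorem fin10 {R : Type*} [Ring R] [Algebra ℂ R] (q u x : ℂ) (hq : q ≠ 0) (hu : u ≠ 0) (k1 k2 k1i k2i e1 e2 f1 f2 O : R)
    (hK : k1 * k2 * O = O * (k1 * k2)) (hKi : k1i * k2i * O = O * (k1i * k2i)) (he1 : e1 * O = O * e1)
    (h : k1i * (e2 * k2) * O = O * (k1i * (e2 * k2) - k1i * k1i * e1 * (k1 * k2)))
    (h' : (e1 * k1 * k2i + k1 * (e2 * k2)) * O = O * (k1 * (e2 * k2))) :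
    ((((q - q⁻¹) * (x * u ^ 2)) • (e1 * k1)) * (k2 - (q⁻¹ * (x * u⁻¹ ^ 2)) • k2i) + (k1i - (q⁻¹ * (x * u ^ 2)) • k1) * (((q - q⁻¹) * (x * u⁻¹ ^ 2)) • (e2 * k2))) * O
      = O * (((((q - q⁻¹) * x * u) • ((u ^ 2 • (1 : R) - u⁻¹ ^ 2 • (k1i * k1i)) * e1 * k1)) * (1 : R) + (u⁻¹ • k1i - (q⁻¹ * x * u) • k1) * (((q - q⁻¹) * x) • e2)) * (u⁻¹ • k2) + ((((q - q⁻¹) * x * u) • ((u ^ 2 • (1 : R) - u⁻¹ ^ 2 • (k1i * k1i)) * e1 * k1)) * (0 : R) + (u⁻¹ • k1i - (q⁻¹ * x * u) • k1) * (1 : R)) * (0 : R)) := by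
  linear_combination (norm := (simp only [mul_add, add_mul, mul_sub, sub_mul, mul_assoc, smul_mul_assoc, mul_smul_comm,
    neg_mul, mul_neg, smul_add, smul_sub, smul_neg, smul_smul, mul_one, one_mul, mul_zero, zero_mul,
    smul_zero, add_zero, zero_add]; match_scalars <;> field_simp <;> try ring))
    ((q - q⁻¹) * x * u ^ 2) • (e1 * hK) + ((q - q⁻¹) * x * u ^ 2) • (he1 * k1 * k2) + ((q - q⁻¹) * x * u⁻¹ ^ 2) • h - ((q - q⁻¹) * q⁻¹ * x ^ 2) • h'

theorem fin11 {R : Type*} [Ring R] [Algebra ℂ R] (q u x : ℂ) (hq : q ≠ 0) (hu : u ≠ 0) (k1 k2 k1i k2i e1 e2 f1 f2 O : R)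
    (hK : k1 * k2 * O = O * (k1 * k2)) (hKi : k1i * k2i * O = O * (k1i * k2i)) (he1 : e1 * O = O * e1)
    (h : (((q - q⁻¹) * (q - q⁻¹)) • (e1 * k1 * (f2 * k2i)) - q⁻¹ • (k1 * k2i)) * O = O * (-(q⁻¹ • (k1 * k2i)))) :
    ((((q - q⁻¹) * (x * u ^ 2)) • (e1 * k1)) * ((q - q⁻¹) • (f2 * k2i)) + (k1i - (q⁻¹ * (x * u ^ 2)) • k1) * k2i) * O
      = O * (((((q - q⁻¹) * x * u) • ((u ^ 2 • (1 : R) - u⁻¹ ^ 2 • (k1i * k1i)) * e1 * k1)) * (1 : R) + (u⁻¹ • k1i - (q⁻¹ * x * u) • k1) * (((q - q⁻¹) * x) • e2)) * (0 : R) + ((((q - q⁻¹) * x * u) • ((u ^ 2 • (1 : R) - u⁻¹ ^ 2 • (k1i * k1i)) * e1 * k1)) * (0 : R) + (u⁻¹ • k1i - (q⁻¹ * x * u) • k1) * (1 : R)) * (u • k2i)) := by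
  linear_combination (norm := (simp only [mul_add, add_mul, mul_sub, sub_mul, mul_assoc, smul_mul_assoc, mul_smul_comm,
    neg_mul, mul_neg, smul_add, smul_sub, smul_neg, smul_smul, mul_one, one_mul, mul_zero, zero_mul,
    smul_zero, add_zero, zero_add]; match_scalars <;> field_simp <;> try ring))
    hKi + (x * u ^ 2) • h

theorem conj {a b c d : E} (h1 : c * d = 1) (h2 : a * d = d * b) : c * a * d = b := by
  rw [mul_assoc, h2, ← mul_assoc, h1, one_mul]

end stmt17

/-- matrix factorization of L-operators. `O = exp_{q⁻²}(λ e₁⊗f₂)` is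
invertible on W₁⊗W₂ and, with `u = q^{μ/2}` (so `q^μ = u²`),
`O⁻¹ L⁽¹⁾(xq^μ) L⁽²⁾(xq^{-μ}) O = M(x)·[[1,0],[λx e₂,1]]·diag(q^{(h₂-μ)/2}, q^{-(h₂-μ)/2})`
as an identity of 2×2 matrices of operators. -/
theorem stmt17 (q u x : ℂ) (hq : q ≠ 0) (hroot : ∀ n : ℕ, n ≠ 0 → q ^ n ≠ 1)
    (hu : u ≠ 0) :
    ∃ Oinv : stmt17.E,
      stmt17.Oop q * Oinv = 1 ∧ Oinv * stmt17.Oop q = 1 ∧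
      (Matrix.of fun i j =>
          Oinv * (stmt17.L1m q (x * u ^ 2) * stmt17.L2m q (x * u⁻¹ ^ 2)) i j *
            stmt17.Oop q)
        = stmt17.Mm q u x * stmt17.Tm q x * stmt17.Dm q u := by
  obtain ⟨Oinv, h1, h2⟩ := stmt17.O_inv hq
  refine ⟨Oinv, h1, h2, ?_⟩
  ext i j : 1
  rw [Matrix.of_apply]
  apply stmt17.conj h2
  simp only [Matrix.mul_apply, Fin.sum_univ_two, stmt17.L1m, stmt17.L2m, stmt17.Mm, stmt17.Tm, stmt17.Dm,
    stmt17.E1op, stmt17.qmh1_eq]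
  fin_cases i <;> fin_cases j
  · exact stmt17.fin00 (R := stmt17.E) q u x hq hu (stmt17.kh1 q) (stmt17.kh2 q) (stmt17.kh1i q) (stmt17.kh2i q) (stmt17.e1 q) (stmt17.e2 q) stmt17.f1 stmt17.f2 (stmt17.Oop q)
        (stmt17.rK hq hroot) (stmt17.rKi hq hroot) (stmt17.re1 hq hroot) (stmt17.E11 hq hroot)
  · exact stmt17.fin01 (R := stmt17.E) q u x hq hu (stmt17.kh1 q) (stmt17.kh2 q) (stmt17.kh1i q) (stmt17.kh2i q) (stmt17.e1 q) (stmt17.e2 q) stmt17.f1 stmt17.f2 (stmt17.Oop q)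
        (stmt17.rK hq hroot) (stmt17.rKi hq hroot) (stmt17.re1 hq hroot) (stmt17.E12 hq hroot)
  · exact stmt17.fin10 (R := stmt17.E) q u x hq hu (stmt17.kh1 q) (stmt17.kh2 q) (stmt17.kh1i q) (stmt17.kh2i q) (stmt17.e1 q) (stmt17.e2 q) stmt17.f1 stmt17.f2 (stmt17.Oop q)
        (stmt17.rK hq hroot) (stmt17.rKi hq hroot) (stmt17.re1 hq hroot) (stmt17.E21a hq hroot) (stmt17.E21b hq hroot)
  · exact stmt17.fin11 (R := stmt17.E) q u x hq hu (stmt17.kh1 q) (stmt17.kh2 q) (stmt17.kh1i q) (stmt17.kh2i q) (stmt17.e1 q) (stmt17.e2 q) stmt17.f1 stmt17.f2 (stmt17.Oop q)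
        (stmt17.rK hq hroot) (stmt17.rKi hq hroot) (stmt17.re1 hq hroot) (stmt17.E22 hq hroot)
end
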